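/- arXiv:0812.3166 — 8 statements merged into one kernel-verified Lean document; each statement's English description precedes it below -/
import Mathlib

section
/- There are no II-flat polynomial translation surfaces: if α, β : ℝ → ℝ are polynomial functions, neither of which is constant (so that the second fundamental form of the translation surface r(u,v) = (u, v, f(u)+g(v)) with f' = α, g' = β is non-degenerate on a dense open set), then the expression num(u,v) = −2α²α'²β' − 2α'β²β'² + 2α²α'β'² + 2α'²β²β' + 2α'β'² + 2α'²β' + α'ββ'' + αα''β' + α²α'ββ'' + αα''β²β' + α'β³β'' + α³α''β' does not vanish identically on ℝ². Equivalently: if num(u,v) = 0 for all u, v ∈ ℝ, then α is constant or β is constant. -/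
/-- The numerator of the second Gaussian curvature `K_II` of the translation
surface `r(u,v) = (u, v, f(u) + g(v))`, where `α = f'` and `β = g'`. -/
noncomputable def num (α β : ℝ → ℝ) (u v : ℝ) : ℝ :=
  -2 * α u ^ 2 * deriv α u ^ 2 * deriv β v
  - 2 * deriv α u * β v ^ 2 * deriv β v ^ 2
  + 2 * α u ^ 2 * deriv α u * deriv β v ^ 2
  + 2 * deriv α u ^ 2 * β v ^ 2 * deriv β v
  + 2 * deriv α u * deriv β v ^ 2
  + 2 * deriv α u ^ 2 * deriv β v
  + deriv α u * β v * deriv (deriv β) v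
  + α u * deriv (deriv α) u * deriv β v
  + α u ^ 2 * deriv α u * β v * deriv (deriv β) v
  + α u * deriv (deriv α) u * β v ^ 2 * deriv β v
  + deriv α u * β v ^ 3 * deriv (deriv β) v
  + α u ^ 3 * deriv (deriv α) u * deriv β v

open Polynomial in
theorem natDegree_le_one_of_curvature_identity {P : ℝ[X]} {q k₁ k₂ k₃ k₄ : ℝ} (hq : q ≠ 0)
    (h : C q * ((P * derivative (derivative P) - C 2 * derivative P ^ 2) * P ^ 2) +
      (C k₁ * derivative P + C k₂ * (derivative P * P ^ 2) +
        C k₃ * (P * derivative (derivative P)) + C k₄ * derivative P ^ 2) = 0) :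
    P.natDegree ≤ 1 := by
  by_contra! hdeg
  obtain ⟨k, hk⟩ := Nat.exists_eq_add_of_le hdeg
  have d0 : P.natDegree ≤ k + 2 := by omega
  have d1 : (derivative P).natDegree ≤ k + 1 := by
    have := natDegree_derivative_le P
    omega
  have d2 : (derivative (derivative P)).natDegree ≤ k := by
    have := natDegree_derivative_le (derivative P)
    omega
  have hP2 : (P ^ 2).natDegree ≤ 2 * (k + 2) := natDegree_pow_le_of_le 2 d0
  have hD2 : (derivative P ^ 2).natDegree ≤ 2 * (k + 1) := natDegree_pow_le_of_le 2 d1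
  have hPD : (P * derivative (derivative P)).natDegree ≤ k + 2 + k := natDegree_mul_le_of_le d0 d2
  have hDP : (derivative P * P ^ 2).natDegree ≤ k + 1 + 2 * (k + 2) :=
    natDegree_mul_le_of_le d1 hP2
  have hmain : (P * derivative (derivative P) - C 2 * derivative P ^ 2).natDegree ≤ 2 * (k + 1) := by
    refine (natDegree_sub_le _ _).trans (max_le (by omega) ?_)
    exact (natDegree_C_mul_le _ _).trans hD2
  have hlead : P.coeff (k + 2) ≠ 0 := by
    have hP0 : P ≠ 0 := by
      rintro rfl
      simp at hdeg
    have := leadingCoeff_ne_zero.mpr hP0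
    rwa [leadingCoeff, show P.natDegree = k + 2 by omega] at this
  have c1 : (derivative P).coeff (k + 1) = P.coeff (k + 2) * (k + 2) := by
    rw [coeff_derivative]
    push_cast
    ring
  have c2 : (derivative (derivative P)).coeff k = P.coeff (k + 2) * (k + 2) * (k + 1) := by
    rw [coeff_derivative, c1]
  have cPD : (P * derivative (derivative P)).coeff (2 * (k + 1)) =
      P.coeff (k + 2) * (P.coeff (k + 2) * (k + 2) * (k + 1)) := by
    rw [show 2 * (k + 1) = k + 2 + k by ring, coeff_mul_add_eq_of_natDegree_le d0 d2, c2]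
  have cD2 : (derivative P ^ 2).coeff (2 * (k + 1)) = (P.coeff (k + 2) * (k + 2)) ^ 2 := by
    rw [coeff_pow_of_natDegree_le d1, c1]
  have cP2 : (P ^ 2).coeff (2 * (k + 2)) = P.coeff (k + 2) ^ 2 := coeff_pow_of_natDegree_le d0
  have hcoeff := congrArg (fun p => coeff p (2 * (k + 1) + 2 * (k + 2))) h
  simp only [coeff_add, coeff_C_mul, coeff_zero] at hcoeff
  rw [coeff_mul_add_eq_of_natDegree_le hmain hP2, coeff_sub, coeff_C_mul, cPD, cD2, cP2,
    coeff_eq_zero_of_natDegree_lt (p := derivative P) (by omega),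
    coeff_eq_zero_of_natDegree_lt (p := derivative P * P ^ 2) (by omega),
    coeff_eq_zero_of_natDegree_lt (p := P * derivative (derivative P)) (by omega),
    coeff_eq_zero_of_natDegree_lt (p := derivative P ^ 2) (by omega)] at hcoeff
  have hprod : q * P.coeff (k + 2) ^ 4 * (((k : ℝ) + 2) * (k + 3)) = 0 := by linarith
  have : ((k : ℝ) + 2) * (k + 3) ≠ 0 := by positivity
  exact mul_ne_zero (mul_ne_zero hq (pow_ne_zero 4 hlead)) this hprod

theorem Polynomial.deriv_eval_eq (P : Polynomial ℝ) :
    deriv (fun x => P.eval x) = fun x => (Polynomial.derivative P).eval x :=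
  _root_.funext fun _ => P.deriv

theorem num_comm (α β : ℝ → ℝ) (u v : ℝ) : num α β u v = num β α v u := by
  unfold num
  ring

open Polynomial in
theorem natDegree_le_one_of_num_eq_zero {P Q : ℝ[X]} (hQ : derivative Q ≠ 0)
    (h : ∀ u v : ℝ, num (fun x => P.eval x) (fun x => Q.eval x) u v = 0) :
    P.natDegree ≤ 1 := by
  obtain ⟨v, hv⟩ : ∃ v, (derivative Q).eval v ≠ 0 := by
    by_contra! hzero
    exact hQ (Polynomial.funext fun x => by simpa using hzero x)
  set b := Q.eval v with hb
  set q := (derivative Q).eval v with hq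
  set t := (derivative (derivative Q)).eval v with ht
  refine natDegree_le_one_of_curvature_identity (q := q)
    (k₁ := b * t * (1 + b ^ 2) + 2 * q ^ 2 * (1 - b ^ 2)) (k₂ := b * t + 2 * q ^ 2)
    (k₃ := q * (1 + b ^ 2)) (k₄ := 2 * q * (1 + b ^ 2)) hv (Polynomial.funext fun u => ?_)
  have hu := h u v
  simp only [num, Polynomial.deriv_eval_eq, ← hb, ← hq, ← ht] at hu
  simp only [eval_add, eval_sub, eval_mul, eval_pow, eval_C, eval_zero]
  linear_combination hu

/-- There are no II-flat polynomial translation surfaces: if `α` and `β` are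
polynomial functions and the numerator of `K_II` vanishes identically, then
`α` is constant or `β` is constant. -/
theorem stmt_0 (P Q : Polynomial ℝ)
    (h : ∀ u v : ℝ, num (fun x => P.eval x) (fun x => Q.eval x) u v = 0) :
    (∃ c : ℝ, ∀ x : ℝ, P.eval x = c) ∨ (∃ c : ℝ, ∀ x : ℝ, Q.eval x = c) := by
  have hconst : ∀ R : Polynomial ℝ, (¬ ∃ c : ℝ, ∀ x : ℝ, R.eval x = c) →
      Polynomial.derivative R ≠ 0 := by
    intro R hR hd
    refine hR ⟨R.coeff 0, fun x => ?_⟩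
    rw [Polynomial.eq_C_of_derivative_eq_zero hd]
    simp
  by_contra! hne
  have hP := hconst P (by push Not; exact hne.1)
  have hQ := hconst Q (by push Not; exact hne.2)
  obtain ⟨a, c, rfl⟩ := Polynomial.exists_eq_X_add_C_of_natDegree_le_one
    (natDegree_le_one_of_num_eq_zero hQ h)
  obtain ⟨b, d, rfl⟩ := Polynomial.exists_eq_X_add_C_of_natDegree_le_one
    (natDegree_le_one_of_num_eq_zero hP fun u v => (num_comm _ _ u v).trans (h v u))
  have ha : a ≠ 0 := by
    rintro rfl
    simp at hP
  have hb : b ≠ 0 := by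
    rintro rfl
    simp at hQ
  have hlin (u v : ℝ) : 2 * a * b * (a * (1 + (b * v + d) ^ 2 - (a * u + c) ^ 2) +
      b * (1 + (a * u + c) ^ 2 - (b * v + d) ^ 2)) = 0 := by
    have huv := h u v
    simp only [num, Polynomial.deriv_eval_eq] at huv
    simp at huv
    linear_combination huv
  have hv : b * (-d / b) + d = 0 := by field_simp; ring
  have hu₁ : a * ((1 - c) / a) + c = 1 := by field_simp; ring
  have h₁ := hlin ((1 - c) / a) (-d / b)
  rw [hv, hu₁] at h₁
  have hba : a * b * b = 0 := by linear_combination h₁ / 4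
  exact mul_ne_zero (mul_ne_zero ha hb) hb hba
end

section
/- For every real c ≠ 0, the translation surface r(u,v) = (u, v, c(u^(4/3) − v^(4/3))) on the quadrant u, v > 0, i.e., with α(u) = (4c/3)u^(1/3) and β(v) = −(4c/3)v^(1/3), satisfies α'(u)β'(v) ≠ 0 for all u, v > 0 (non-degenerate second fundamental form) and num(u,v) = 0 for all u, v > 0; hence its second Gaussian curvature K_II vanishes identically (a scaled version of Blair's example of a non-minimal surface with vanishing second Gaussian curvature). -/
/-- If `α α'' = -2 α'²`, `β β'' = -2 β'²` and `α² α' + β² β' = 0` at a point, then `num` vanishes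
there. -/
theorem num_eq_zero_of_ode {α β : ℝ → ℝ} {u v : ℝ}
    (hα : α u * deriv (deriv α) u = -2 * deriv α u ^ 2)
    (hβ : β v * deriv (deriv β) v = -2 * deriv β v ^ 2)
    (h : α u ^ 2 * deriv α u + β v ^ 2 * deriv β v = 0) : num α β u v = 0 := by
  unfold num
  linear_combination (deriv β v * (1 + α u ^ 2 + β v ^ 2)) * hα +
    (deriv α u * (1 + α u ^ 2 + β v ^ 2)) * hβ - 4 * deriv α u * deriv β v * h

theorem deriv_const_mul_rpow (k r : ℝ) {x : ℝ} (hx : 0 < x) :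
    deriv (fun y : ℝ => k * y ^ r) x = k * r * x ^ (r - 1) := by
  rw [((Real.hasDerivAt_rpow_const (Or.inl hx.ne')).const_mul k).deriv, mul_assoc]

theorem deriv_deriv_const_mul_rpow (k r : ℝ) {x : ℝ} (hx : 0 < x) :
    deriv (deriv fun y : ℝ => k * y ^ r) x = k * r * (r - 1) * x ^ (r - 2) := by
  have h : deriv (fun y : ℝ => k * y ^ r) =ᶠ[nhds x] fun y => k * r * y ^ (r - 1) := by
    filter_upwards [lt_mem_nhds hx] with y hy using deriv_const_mul_rpow k r hy
  rw [h.deriv_eq, deriv_const_mul_rpow _ _ hx]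
  ring_nf

theorem deriv_const_mul_rpow_third_ne_zero {k x : ℝ} (hk : k ≠ 0) (hx : 0 < x) :
    deriv (fun y : ℝ => k * y ^ ((1 : ℝ) / 3)) x ≠ 0 := by
  rw [deriv_const_mul_rpow _ _ hx]
  have := Real.rpow_pos_of_pos hx ((1 : ℝ) / 3 - 1)
  positivity

/-- `α = k x^(1/3)` satisfies `α α'' = -2 α'²`. -/
theorem const_mul_rpow_third_mul_deriv_deriv (k : ℝ) {x : ℝ} (hx : 0 < x) :
    k * x ^ ((1 : ℝ) / 3) * deriv (deriv fun y : ℝ => k * y ^ ((1 : ℝ) / 3)) x =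
      -2 * deriv (fun y : ℝ => k * y ^ ((1 : ℝ) / 3)) x ^ 2 := by
  rw [deriv_deriv_const_mul_rpow _ _ hx, deriv_const_mul_rpow _ _ hx]
  have h : x ^ ((1 : ℝ) / 3) * x ^ ((1 : ℝ) / 3 - 2) = (x ^ ((1 : ℝ) / 3 - 1)) ^ 2 := by
    rw [sq, ← Real.rpow_add hx, ← Real.rpow_add hx]
    norm_num
  linear_combination (-2 / 9) * k ^ 2 * h

/-- `α = k x^(1/3)` satisfies `α² α' = k³ / 3`. -/
theorem const_mul_rpow_third_sq_mul_deriv (k : ℝ) {x : ℝ} (hx : 0 < x) :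
    (k * x ^ ((1 : ℝ) / 3)) ^ 2 * deriv (fun y : ℝ => k * y ^ ((1 : ℝ) / 3)) x = k ^ 3 / 3 := by
  rw [deriv_const_mul_rpow _ _ hx]
  have h : (x ^ ((1 : ℝ) / 3)) ^ 2 * x ^ ((1 : ℝ) / 3 - 1) = 1 := by
    rw [sq, ← Real.rpow_add hx, ← Real.rpow_add hx]
    norm_num
  linear_combination k ^ 3 / 3 * h

/-- Blair's example (scaled): the translation surface
`r(u,v) = (u, v, c(u^(4/3) - v^(4/3)))`, i.e. `α(u) = (4c/3)u^(1/3)`,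
`β(v) = -(4c/3)v^(1/3)`, has non-degenerate second fundamental form on the
positive quadrant and vanishing second Gaussian curvature there. -/
theorem stmt_2 (c : ℝ) (hc : c ≠ 0) :
    ∀ u v : ℝ, 0 < u → 0 < v →
      deriv (fun x : ℝ => (4 * c / 3) * x ^ ((1 : ℝ)/3)) u ≠ 0 ∧
      deriv (fun x : ℝ => -(4 * c / 3) * x ^ ((1 : ℝ)/3)) v ≠ 0 ∧
      num (fun x : ℝ => (4 * c / 3) * x ^ ((1 : ℝ)/3))
          (fun x : ℝ => -(4 * c / 3) * x ^ ((1 : ℝ)/3)) u v = 0 ∧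
      num (fun x : ℝ => (4 * c / 3) * x ^ ((1 : ℝ)/3))
          (fun x : ℝ => -(4 * c / 3) * x ^ ((1 : ℝ)/3)) u v /
        (4 * deriv (fun x : ℝ => (4 * c / 3) * x ^ ((1 : ℝ)/3)) u *
          deriv (fun x : ℝ => -(4 * c / 3) * x ^ ((1 : ℝ)/3)) v *
          (1 + ((4 * c / 3) * u ^ ((1 : ℝ)/3)) ^ 2 +
            (-(4 * c / 3) * v ^ ((1 : ℝ)/3)) ^ 2) ^ ((3 : ℝ)/2)) = 0 := by
  intro u v hu hv
  have hk : 4 * c / 3 ≠ 0 := by positivity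
  have hnum : num (fun x : ℝ => (4 * c / 3) * x ^ ((1 : ℝ)/3))
      (fun x : ℝ => -(4 * c / 3) * x ^ ((1 : ℝ)/3)) u v = 0 := by
    refine num_eq_zero_of_ode (const_mul_rpow_third_mul_deriv_deriv _ hu)
      (const_mul_rpow_third_mul_deriv_deriv _ hv) ?_
    linear_combination const_mul_rpow_third_sq_mul_deriv (4 * c / 3) hu +
      const_mul_rpow_third_sq_mul_deriv (-(4 * c / 3)) hv
  exact ⟨deriv_const_mul_rpow_third_ne_zero hk hu,
    deriv_const_mul_rpow_third_ne_zero (neg_ne_zero.mpr hk) hv, hnum, by rw [hnum, zero_div]⟩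
end

section
/- Let c ≠ 0 and let I, J be open intervals on which cos(cu/2) ≠ 0 and cos(cv/2) ≠ 0 respectively. Set α(u) = −tan(cu/2) on I and β(v) = tan(cv/2) on J (the Scherk-type surface r(u,v) = (u, v, (2/c) ln|cos(cu/2)/cos(cv/2)|)). Then α'(u) ≠ 0 and β'(v) ≠ 0 everywhere, and both the mean curvature H and the numerator num of the second Gaussian curvature vanish identically on I × J; in particular K_II = H = 0 for this surface. -/
theorem hasDerivAt_tan_mul_div_two (c x : ℝ) (hx : Real.cos (c * x / 2) ≠ 0) :
    HasDerivAt (fun x : ℝ => Real.tan (c * x / 2)) (c / 2 * (1 + Real.tan (c * x / 2) ^ 2)) x := by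
  have hlin : HasDerivAt (fun x : ℝ => c * x / 2) (c / 2) x := by
    simpa using ((hasDerivAt_id x).const_mul c).div_const 2
  refine ((Real.hasDerivAt_tan hx).comp x hlin).congr_deriv ?_
  rw [one_div, ← Real.inv_one_add_tan_sq hx, inv_inv, mul_comm]

theorem deriv_tan_mul_div_two_eventuallyEq (c x : ℝ) (hx : Real.cos (c * x / 2) ≠ 0) :
    deriv (fun x : ℝ => Real.tan (c * x / 2)) =ᶠ[nhds x]
      fun x => c / 2 * (1 + Real.tan (c * x / 2) ^ 2) := by
  have hcont : Continuous fun x : ℝ => Real.cos (c * x / 2) := by fun_prop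
  filter_upwards [hcont.continuousAt.eventually_ne hx] with y hy
  exact (hasDerivAt_tan_mul_div_two c y hy).deriv

theorem deriv_deriv_tan_mul_div_two (c x : ℝ) (hx : Real.cos (c * x / 2) ≠ 0) :
    deriv (deriv (fun x : ℝ => Real.tan (c * x / 2))) x =
      c ^ 2 / 2 * Real.tan (c * x / 2) * (1 + Real.tan (c * x / 2) ^ 2) := by
  rw [(deriv_tan_mul_div_two_eventuallyEq c x hx).deriv_eq]
  refine ((((hasDerivAt_tan_mul_div_two c x hx).pow 2).const_add 1).const_mul (c / 2)).deriv.trans ?_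
  push_cast
  ring

/-- The Scherk-type surface `r(u,v) = (u, v, (2/c) ln|cos(cu/2)/cos(cv/2)|)`,
i.e. `α(u) = -tan(cu/2)`, `β(v) = tan(cv/2)`, has nowhere vanishing `α'`, `β'`,
and both its mean curvature `H` and the numerator `num` of `K_II` vanish
identically; in particular `K_II = H = 0`. -/
theorem stmt_4 (c : ℝ) (hc : c ≠ 0) (I J : Set ℝ)
    (hIopen : IsOpen I) (hIconv : Convex ℝ I)
    (hJopen : IsOpen J) (hJconv : Convex ℝ J)
    (hI : ∀ u ∈ I, Real.cos (c * u / 2) ≠ 0)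
    (hJ : ∀ v ∈ J, Real.cos (c * v / 2) ≠ 0) :
    (∀ u ∈ I, deriv (fun x : ℝ => - Real.tan (c * x / 2)) u ≠ 0) ∧
    (∀ v ∈ J, deriv (fun x : ℝ => Real.tan (c * x / 2)) v ≠ 0) ∧
    (∀ u ∈ I, ∀ v ∈ J,
      ((1 + Real.tan (c * v / 2) ^ 2) * deriv (fun x : ℝ => - Real.tan (c * x / 2)) u
        + (1 + (- Real.tan (c * u / 2)) ^ 2) * deriv (fun x : ℝ => Real.tan (c * x / 2)) v) /
        (2 * (1 + (- Real.tan (c * u / 2)) ^ 2 + Real.tan (c * v / 2) ^ 2) ^ ((3 : ℝ)/2)) = 0 ∧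
      num (fun x : ℝ => - Real.tan (c * x / 2)) (fun x : ℝ => Real.tan (c * x / 2)) u v = 0) := by
  have hα : deriv (fun x : ℝ => - Real.tan (c * x / 2)) =
      fun x => - deriv (fun x : ℝ => Real.tan (c * x / 2)) x := deriv.fun_neg'
  have hderiv : ∀ x, Real.cos (c * x / 2) ≠ 0 →
      deriv (fun x : ℝ => Real.tan (c * x / 2)) x = c / 2 * (1 + Real.tan (c * x / 2) ^ 2) :=
    fun x hx => (hasDerivAt_tan_mul_div_two c x hx).deriv
  have hne : ∀ x, Real.cos (c * x / 2) ≠ 0 →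
      deriv (fun x : ℝ => Real.tan (c * x / 2)) x ≠ 0 := fun x hx => by
    rw [hderiv x hx]
    positivity
  refine ⟨fun u hu => ?_, fun v hv => hne v (hJ v hv), fun u hu v hv => ⟨?_, ?_⟩⟩
  · rw [hα]
    exact neg_ne_zero.mpr (hne u (hI u hu))
  · rw [hα, hderiv v (hJ v hv)]
    beta_reduce
    rw [hderiv u (hI u hu)]
    refine div_eq_zero_iff.mpr (Or.inl ?_)
    ring
  · have hα₂ : deriv (fun x => - deriv (fun x : ℝ => Real.tan (c * x / 2)) x) u =
        - deriv (deriv fun x : ℝ => Real.tan (c * x / 2)) u := deriv.fun_neg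
    simp only [num]
    rw [hα, hα₂, deriv_deriv_tan_mul_div_two c u (hI u hu),
      deriv_deriv_tan_mul_div_two c v (hJ v hv), hderiv v (hJ v hv)]
    beta_reduce
    rw [hderiv u (hI u hu)]
    ring
end

section
/- Let I, J ⊆ ℝ be open intervals, τ₁, τ₂, ν ∈ ℝ, and let α : I → ℝ, β : J → ℝ be smooth functions satisfying the ODEs α'(u) = τ₁α(u)² − ν/2 on I and β'(v) = τ₂β(v)² + ν/2 on J, with α'(u) ≠ 0 and β'(v) ≠ 0 everywhere. Then num(u,v) = 4α'(u)β'(v)·((1+β(v)²)α'(u) + (1+α(u)²)β'(v)) for all (u,v) ∈ I × J; i.e., the corresponding translation surface satisfies K_II = 2H. (Equivalently, for α'β' nowhere zero, K_II = 2H holds if and only if −2α' + αα''/α' − 2β' + ββ''/β' = 0 on I × J.) -/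
/-- Differentiating the Riccati-type equation `f' = τ f² + c` gives `f'' = 2 τ f f'`. -/
theorem deriv_deriv_of_riccati {S : Set ℝ} (hS : IsOpen S) {f : ℝ → ℝ} {τ c : ℝ}
    (hf : DifferentiableOn ℝ f S) (hode : ∀ x ∈ S, deriv f x = τ * f x ^ 2 + c)
    {x : ℝ} (hx : x ∈ S) : deriv (deriv f) x = 2 * τ * f x * deriv f x := by
  have hmem : S ∈ nhds x := hS.mem_nhds hx
  have heq : deriv f =ᶠ[nhds x] fun y => τ * f y ^ 2 + c :=
    Filter.mem_of_superset hmem hode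
  have hfx : HasDerivAt f (deriv f x) x := (hf.differentiableAt hmem).hasDerivAt
  rw [heq.deriv_eq, (((hfx.fun_pow 2).const_mul τ).add_const c).deriv]
  push_cast
  ring

/-- If `α` and `β` satisfy the Riccati-type ODEs `α' = τ₁α² - ν/2` and
`β' = τ₂β² + ν/2` with `α'`, `β'` nowhere vanishing, then the corresponding
translation surface satisfies `K_II = 2H`, i.e.
`num = 4α'β'((1+β²)α' + (1+α²)β')`. -/
theorem stmt_7 (I J : Set ℝ) (hIopen : IsOpen I) (hIconv : Convex ℝ I)
    (hJopen : IsOpen J) (hJconv : Convex ℝ J) (τ₁ τ₂ ν : ℝ)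
    (α β : ℝ → ℝ) (hα : ContDiffOn ℝ (⊤ : ℕ∞) α I) (hβ : ContDiffOn ℝ (⊤ : ℕ∞) β J)
    (hode₁ : ∀ u ∈ I, deriv α u = τ₁ * α u ^ 2 - ν / 2)
    (hode₂ : ∀ v ∈ J, deriv β v = τ₂ * β v ^ 2 + ν / 2)
    (hα' : ∀ u ∈ I, deriv α u ≠ 0) (hβ' : ∀ v ∈ J, deriv β v ≠ 0) :
    ∀ u ∈ I, ∀ v ∈ J,
      num α β u v = 4 * deriv α u * deriv β v *
        ((1 + β v ^ 2) * deriv α u + (1 + α u ^ 2) * deriv β v) := by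
  intro u hu v hv
  have hα₂ := deriv_deriv_of_riccati hIopen (c := -(ν / 2)) (hα.differentiableOn (by simp))
    (fun x hx => by rw [hode₁ x hx, sub_eq_add_neg]) hu
  have hβ₂ := deriv_deriv_of_riccati hJopen (hβ.differentiableOn (by simp)) hode₂ hv
  rw [num, hα₂, hβ₂, hode₁ u hu, hode₂ v hv]
  ring
end

section
/- Let p, q ≠ 0 and ν ≠ 0, and consider the translation surface r(u,v) = (u, v, (ν/2)·ln(cos(pu)^(1/p²)/cos(qv)^(1/q²))), i.e., f(u) = (ν/(2p²))ln(cos(pu)) and g(v) = −(ν/(2q²))ln(cos(qv)) on intervals where cos(pu) > 0 and cos(qv) > 0, so that α(u) = −(ν/(2p))tan(pu) and β(v) = (ν/(2q))tan(qv). Then α'(u) ≠ 0 and β'(v) ≠ 0 everywhere on the domain, and num(u,v) = 4α'(u)β'(v)·((1+β(v)²)α'(u) + (1+α(u)²)β'(v)); i.e., this surface satisfies K_II = 2H. -/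
/-- The derivative of a scaled tangent. -/
lemma deriv_const_mul_tan_mul (c k : ℝ) {x : ℝ} (hx : Real.cos (k * x) ≠ 0) :
    deriv (fun y : ℝ => c * Real.tan (k * y)) x = c * k * (1 + Real.tan (k * x) ^ 2) := by
  have hk : HasDerivAt (fun y : ℝ => k * y) k x := by
    simpa using (hasDerivAt_id x).const_mul k
  have h := (((Real.hasDerivAt_tan hx).comp x hk).const_mul c).deriv
  have hcos : 1 / Real.cos (k * x) ^ 2 = 1 + Real.tan (k * x) ^ 2 := by
    rw [one_div, ← Real.inv_one_add_tan_sq hx, inv_inv]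
  rw [hcos] at h
  refine h.trans ?_
  ring

/-- The second derivative of a scaled tangent. -/
lemma deriv_deriv_const_mul_tan_mul (c k : ℝ) {x : ℝ} (hx : Real.cos (k * x) ≠ 0) :
    deriv (deriv (fun y : ℝ => c * Real.tan (k * y))) x =
      2 * c * k ^ 2 * Real.tan (k * x) * (1 + Real.tan (k * x) ^ 2) := by
  have hev : deriv (fun y : ℝ => c * Real.tan (k * y)) =ᶠ[nhds x]
      fun y => c * k * (1 + Real.tan (k * y) ^ 2) := by
    have hc : ContinuousAt (fun y : ℝ => Real.cos (k * y)) x := by fun_prop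
    filter_upwards [hc.eventually_ne hx] with y hy
    exact deriv_const_mul_tan_mul c k hy
  have hk : HasDerivAt (fun y : ℝ => k * y) k x := by
    simpa using (hasDerivAt_id x).const_mul k
  have htan : HasDerivAt (fun y : ℝ => Real.tan (k * y))
      (1 * k * (1 + Real.tan (k * x) ^ 2)) x := by
    rw [← deriv_const_mul_tan_mul 1 k hx]
    simp only [one_mul]
    exact ((Real.hasDerivAt_tan hx).comp x hk).differentiableAt.hasDerivAt
  rw [hev.deriv_eq, (((htan.fun_pow 2).const_add 1).const_mul (c * k)).deriv]
  ring

/-- The translation surface `r(u,v) = (u, v, (ν/2)ln(cos(pu)^(1/p²)/cos(qv)^(1/q²)))`,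
i.e. `α(u) = -(ν/(2p))tan(pu)` where `cos(pu) > 0` and `β(v) = (ν/(2q))tan(qv)`
where `cos(qv) > 0`, has nowhere vanishing `α'`, `β'` and satisfies `K_II = 2H`. -/
theorem stmt_10 (p q ν : ℝ) (hp : p ≠ 0) (hq : q ≠ 0) (hν : ν ≠ 0)
    (I J : Set ℝ) (hI : ∀ u ∈ I, 0 < Real.cos (p * u)) (hJ : ∀ v ∈ J, 0 < Real.cos (q * v)) :
    ∀ u ∈ I, ∀ v ∈ J,
      deriv (fun x : ℝ => -(ν / (2 * p)) * Real.tan (p * x)) u ≠ 0 ∧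
      deriv (fun x : ℝ => (ν / (2 * q)) * Real.tan (q * x)) v ≠ 0 ∧
      num (fun x : ℝ => -(ν / (2 * p)) * Real.tan (p * x))
          (fun x : ℝ => (ν / (2 * q)) * Real.tan (q * x)) u v =
        4 * deriv (fun x : ℝ => -(ν / (2 * p)) * Real.tan (p * x)) u *
          deriv (fun x : ℝ => (ν / (2 * q)) * Real.tan (q * x)) v *
          ((1 + ((ν / (2 * q)) * Real.tan (q * v)) ^ 2) *
              deriv (fun x : ℝ => -(ν / (2 * p)) * Real.tan (p * x)) u
            + (1 + (-(ν / (2 * p)) * Real.tan (p * u)) ^ 2) *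
              deriv (fun x : ℝ => (ν / (2 * q)) * Real.tan (q * x)) v) := by
  intro u hu v hv
  have hcu := (hI u hu).ne'
  have hcv := (hJ v hv).ne'
  simp only [num, deriv_const_mul_tan_mul _ _ hcu, deriv_const_mul_tan_mul _ _ hcv,
    deriv_deriv_const_mul_tan_mul _ _ hcu, deriv_deriv_const_mul_tan_mul _ _ hcv]
  refine ⟨?_, ?_, ?_⟩
  · have : 1 + Real.tan (p * u) ^ 2 ≠ 0 := by positivity
    simp [hp, hν, this]
  · have : 1 + Real.tan (q * v) ^ 2 ≠ 0 := by positivity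
    simp [hq, hν, this]
  · field_simp
    ring
end

section
/- Let α, β : ℝ → ℝ be non-constant polynomial functions and let λ ∈ ℝ. If num(u,v) = 2λα'(u)β'(v)·((1+β(v)²)α'(u) + (1+α(u)²)β'(v)) for all u, v ∈ ℝ (i.e., the polynomial translation surface with f' = α, g' = β satisfies K_II = λH wherever the second fundamental form is non-degenerate), then λ = 2 and there exist a ≠ 0 and u₀, v₀ ∈ ℝ such that α(u) = 2a(u−u₀) and β(v) = −2a(v−v₀); i.e., the surface is a hyperbolic paraboloid r(u,v) = (u, v, a(u−u₀)² − a(v−v₀)²). -/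
open Polynomial in
/-- A non-constant real polynomial has non-vanishing derivative at some point. -/
theorem exists_eval_derivative_ne_zero {P : ℝ[X]} (hP : 0 < P.natDegree) :
    ∃ x : ℝ, P.derivative.eval x ≠ 0 := by
  by_contra! h
  have h0 : P.derivative = 0 := Polynomial.funext fun x => by simpa using h x
  exact hP.ne' (derivative_eq_zero.1 h0)

open Polynomial in
/-- For `P` of degree at least two, `P ^ 2 * (P * P'' - 2 * P' ^ 2)` has degree exactly
`4 * deg P - 2`, so it is not a combination of the products `P' ^ 2`, `P'`, `P ^ 2 * P'` and
`P * P''`, all of which have smaller degree. -/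
theorem mul_sub_two_mul_derivative_sq_ne {P : ℝ[X]} (hP : 2 ≤ P.natDegree) {d : ℝ} (hd : d ≠ 0)
    (a₁ a₂ a₃ a₄ : ℝ) :
    C d * (P * P * (P * P.derivative.derivative - C 2 * (P.derivative * P.derivative))) ≠
      C a₁ * (P.derivative * P.derivative) + C a₂ * P.derivative + C a₃ * (P * P * P.derivative)
        + C a₄ * (P * P.derivative.derivative) := by
  intro h
  obtain ⟨k, hk⟩ : ∃ k, P.natDegree = k + 2 := ⟨_, (Nat.sub_add_cancel hP).symm⟩
  have d0 : P.natDegree ≤ k + 2 := hk.le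
  have d1 : P.derivative.natDegree ≤ k + 1 :=
    (natDegree_derivative_le P).trans (by omega)
  have d2 : P.derivative.derivative.natDegree ≤ k :=
    (natDegree_derivative_le _).trans (by omega)
  have dPP := natDegree_mul_le_of_le d0 d0
  have dP2 := natDegree_mul_le_of_le d0 d2
  have d11 := natDegree_mul_le_of_le d1 d1
  have dPP1 := natDegree_mul_le_of_le dPP d1
  have c0 : P.coeff (k + 2) ≠ 0 := by
    rw [← hk, coeff_natDegree, leadingCoeff_ne_zero]
    rintro rfl
    simp at hP
  have cP2 := coeff_mul_add_eq_of_natDegree_le d0 d2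
  have c11 := coeff_mul_add_eq_of_natDegree_le d1 d1
  rw [show k + 1 + (k + 1) = k + 2 + k by ring] at d11 c11
  have dS : (P * P.derivative.derivative - C 2 * (P.derivative * P.derivative)).natDegree
      ≤ k + 2 + k :=
    natDegree_sub_le_of_le dP2 ((natDegree_C_mul_le _ _).trans d11) |>.trans (by simp)
  have hc := congrArg (fun q => coeff q (k + 2 + (k + 2) + (k + 2 + k))) h
  simp only [coeff_add, coeff_C_mul] at hc
  rw [coeff_mul_add_eq_of_natDegree_le dPP dS,
    coeff_mul_add_eq_of_natDegree_le d0 d0,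
    coeff_eq_zero_of_natDegree_lt (d11.trans_lt (by omega)),
    coeff_eq_zero_of_natDegree_lt (d1.trans_lt (by omega)),
    coeff_eq_zero_of_natDegree_lt (dPP1.trans_lt (by omega)),
    coeff_eq_zero_of_natDegree_lt (dP2.trans_lt (by omega)),
    coeff_sub, coeff_C_mul, cP2, c11] at hc
  simp only [coeff_derivative] at hc
  push_cast at hc
  have hpos : (0 : ℝ) < (k + 2) * (k + 3) := by positivity
  have : d * P.coeff (k + 2) ^ 4 * ((k + 2) * (k + 3)) = 0 := by
    linear_combination -hc
  exact mul_ne_zero (mul_ne_zero hd (pow_ne_zero _ c0)) hpos.ne' this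

open Polynomial in
/-- If a non-constant polynomial `P` satisfies the equation `K_II = l * H` along a coordinate
line on which the other function takes the value `c` with derivatives `d ≠ 0` and `e`,
then `P` has degree one. -/
theorem natDegree_eq_one_of_fixed_slice {P : ℝ[X]} (hP : 0 < P.natDegree) {c d e l : ℝ}
    (hd : d ≠ 0)
    (h : ∀ u : ℝ, 2 * P.derivative.eval u * d *
        (P.derivative.eval u * (1 + c ^ 2 - P.eval u ^ 2) + d * (1 + P.eval u ^ 2 - c ^ 2))
        + (1 + P.eval u ^ 2 + c ^ 2) *
          (P.derivative.eval u * (c * e) + P.eval u * P.derivative.derivative.eval u * d)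
      = 2 * l * P.derivative.eval u * d *
        ((1 + c ^ 2) * P.derivative.eval u + (1 + P.eval u ^ 2) * d)) :
    P.natDegree = 1 := by
  by_contra hne
  refine mul_sub_two_mul_derivative_sq_ne (P := P) (by omega) hd
    (2 * d * (1 + c ^ 2) * (l - 1))
    (2 * d ^ 2 * (l - 1 + c ^ 2) - c * e * (1 + c ^ 2))
    (2 * d ^ 2 * (l - 1) - c * e) (-(d * (1 + c ^ 2))) (Polynomial.funext fun u => ?_)
  simp only [eval_add, eval_sub, eval_mul, eval_C]
  linear_combination h u

/-- The only polynomial translation surfaces satisfying `K_II = λH` are the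
hyperbolic paraboloids `r(u,v) = (u, v, a(u-u₀)² - a(v-v₀)²)`, in which case
`λ = 2`: if `α`, `β` are non-constant polynomial functions with
`num = 2λα'β'((1+β²)α' + (1+α²)β')` identically, then `λ = 2`,
`α(u) = 2a(u-u₀)` and `β(v) = -2a(v-v₀)` for some `a ≠ 0`. -/
theorem stmt_11 (P Q : Polynomial ℝ) (hP : 0 < P.natDegree) (hQ : 0 < Q.natDegree) (lam : ℝ)
    (h : ∀ u v : ℝ,
      num (fun x => P.eval x) (fun x => Q.eval x) u v =
        2 * lam * deriv (fun x => P.eval x) u * deriv (fun x => Q.eval x) v *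
          ((1 + Q.eval v ^ 2) * deriv (fun x => P.eval x) u
            + (1 + P.eval u ^ 2) * deriv (fun x => Q.eval x) v)) :
    lam = 2 ∧ ∃ a : ℝ, a ≠ 0 ∧ ∃ u₀ v₀ : ℝ,
      (∀ u : ℝ, P.eval u = 2 * a * (u - u₀)) ∧
      (∀ v : ℝ, Q.eval v = -2 * a * (v - v₀)) := by
  have hderiv (p : Polynomial ℝ) : deriv (fun x => p.eval x) = fun x => p.derivative.eval x :=
    funext fun _ => p.deriv
  simp only [num, hderiv] at h
  obtain ⟨v, hv⟩ := exists_eval_derivative_ne_zero hQ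
  obtain ⟨u, hu⟩ := exists_eval_derivative_ne_zero hP
  have hP1 : P.natDegree = 1 := natDegree_eq_one_of_fixed_slice hP hv
    (c := Q.eval v) (e := Q.derivative.derivative.eval v) (l := lam) fun x => by linear_combination h x v
  have hQ1 : Q.natDegree = 1 := natDegree_eq_one_of_fixed_slice hQ hu
    (c := P.eval u) (e := P.derivative.derivative.eval u) (l := lam) fun x => by linear_combination h u x
  obtain ⟨A, hA, B, rfl⟩ := Polynomial.natDegree_eq_one.1 hP1
  obtain ⟨C, hC, D, rfl⟩ := Polynomial.natDegree_eq_one.1 hQ1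
  simp only [Polynomial.derivative_add, Polynomial.derivative_C_mul, Polynomial.derivative_X,
    Polynomial.derivative_C, Polynomial.eval_add, Polynomial.eval_mul, Polynomial.eval_C,
    Polynomial.eval_X, mul_one, add_zero, Polynomial.eval_zero, mul_zero, zero_mul] at h ⊢
  have key : ∀ x y : ℝ, A * (1 + y ^ 2 - x ^ 2) + C * (1 + x ^ 2 - y ^ 2)
      = lam * ((1 + y ^ 2) * A + (1 + x ^ 2) * C) := by
    intro x y
    have hxy := h ((x - B) / A) ((y - D) / C)
    rw [mul_div_cancel₀ _ hA, mul_div_cancel₀ _ hC, sub_add_cancel, sub_add_cancel] at hxy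
    apply mul_left_cancel₀ (mul_ne_zero hA hC)
    linear_combination hxy / 2
  have h00 := key 0 0
  have h10 := key 1 0
  have h01 := key 0 1
  have hlam : lam * (A + C) = 0 := by linear_combination 2 * h00 - h10 - h01
  have hAC : C = -A := by linear_combination h00 + hlam
  subst hAC
  refine ⟨mul_right_cancel₀ hA (by linear_combination h00 - h01), A / 2,
    div_ne_zero hA two_ne_zero, -B / A, D / A, fun x => ?_, fun x => ?_⟩ <;> field_simp <;> ring
end

section
/- Let p, d ∈ ℝ with (p, d) ≠ (0, 0), and let q ∈ ℝ. Then the set {x ∈ (0, ∞) : p·x² − 2d·x²·ln x + d = q} has at most two elements. (Consequently, a function α satisfying p·α(u)² − 2d·α(u)²·ln|α(u)| + d = q identically, with α' nowhere zero, cannot exist.) -/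
/-- A strictly convex function does not agree with an affine function at three distinct points. -/
theorem StrictConvexOn.false_of_eq_affine {s : Set ℝ} {f : ℝ → ℝ} (hf : StrictConvexOn ℝ s f)
    {a b x y z : ℝ} (hx : x ∈ s) (hz : z ∈ s) (hxy : x < y) (hyz : y < z)
    (ex : f x = a * x + b) (ey : f y = a * y + b) (ez : f z = a * z + b) : False := by
  have key := hf.slope_strict_mono_adjacent hx hz hxy hyz
  rw [ex, ey, ez, div_lt_div_iff₀ (sub_pos.2 hxy) (sub_pos.2 hyz)] at key
  linarith

/-- The function `x ↦ p·x² - 2d·x²·ln x + d` does not take the same value at three points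
`0 < x < y < z` unless `p = d = 0`. -/
theorem false_of_sq_mul_log_eq {p d q x y z : ℝ} (h : ¬(p = 0 ∧ d = 0))
    (hx : 0 < x) (hxy : x < y) (hyz : y < z)
    (ex : p * x ^ 2 - 2 * d * x ^ 2 * Real.log x + d = q)
    (ey : p * y ^ 2 - 2 * d * y ^ 2 * Real.log y + d = q)
    (ez : p * z ^ 2 - 2 * d * z ^ 2 * Real.log z + d = q) : False := by
  have hxy2 : x ^ 2 < y ^ 2 := by gcongr
  have hyz2 : y ^ 2 < z ^ 2 := by have := hx.trans hxy; gcongr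
  by_cases hd : d = 0
  · subst hd
    have hp : p * (y ^ 2 - x ^ 2) = 0 := by linarith
    rcases mul_eq_zero.1 hp with hp | hp
    · exact h ⟨hp, rfl⟩
    · linarith
  · have affine {t : ℝ} (e : p * t ^ 2 - 2 * d * t ^ 2 * Real.log t + d = q) :
        t ^ 2 * Real.log (t ^ 2) = p / d * t ^ 2 + (d - q) / d := by
      rw [Real.log_pow]
      field_simp
      push_cast
      linarith
    exact Real.strictConvexOn_mul_log.false_of_eq_affine (Set.mem_Ici.2 (sq_nonneg x))
      (Set.mem_Ici.2 (sq_nonneg z)) hxy2 hyz2 (affine ex) (affine ey) (affine ez)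

/-- For `(p, d) ≠ (0, 0)`, the function `x ↦ p·x² - 2d·x²·ln x + d` on `(0, ∞)`
takes each value `q` at most twice: among any three positive solutions of
`p·x² - 2d·x²·ln x + d = q`, two coincide. -/
theorem stmt_13 (p d q : ℝ) (h : ¬(p = 0 ∧ d = 0)) :
    ∀ x y z : ℝ, 0 < x → 0 < y → 0 < z →
      p * x ^ 2 - 2 * d * x ^ 2 * Real.log x + d = q →
      p * y ^ 2 - 2 * d * y ^ 2 * Real.log y + d = q →
      p * z ^ 2 - 2 * d * z ^ 2 * Real.log z + d = q →
      x = y ∨ x = z ∨ y = z := by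
  intro x y z hx hy hz ex ey ez
  by_contra! hne
  obtain ⟨hxy, hxz, hyz⟩ := hne
  rcases hxy.lt_or_gt with hxy | hxy <;> rcases hxz.lt_or_gt with hxz | hxz <;>
    rcases hyz.lt_or_gt with hyz | hyz
  · exact false_of_sq_mul_log_eq h hx hxy hyz ex ey ez
  · exact false_of_sq_mul_log_eq h hx hxz hyz ex ez ey
  · linarith
  · exact false_of_sq_mul_log_eq h hz hxz hxy ez ex ey
  · exact false_of_sq_mul_log_eq h hy hxy hxz ey ex ez
  · linarith
  · exact false_of_sq_mul_log_eq h hy hyz hxz ey ez ex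
  · exact false_of_sq_mul_log_eq h hz hyz hxy ez ey ex
end

section
/- Let α, β : ℝ → ℝ be polynomial functions with deg α = m, deg β = n, m > n ≥ 2, and leading coefficients a_m ≠ 0 and b_n ≠ 0 respectively. Then, viewing num(u,v) as a polynomial in the two variables u and v, its coefficient of the monomial u^(4m−2)·v^(n−1) equals −m·n·(m+1)·a_m⁴·b_n, which is nonzero; in particular num is not identically zero, so no polynomial translation surface with deg f' > deg g' ≥ 2 has vanishing second Gaussian curvature. -/
/-- The numerator of the second Gaussian curvature of a polynomial translation
surface, as a bivariate polynomial: an element of `Polynomial (Polynomial ℝ)`,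
with the outer variable `X` standing for `u` and the inner variable for `v`.
Here `P`, `Q` are the polynomials `α = f'` and `β = g'`. -/
noncomputable def numPoly (P Q : Polynomial ℝ) : Polynomial (Polynomial ℝ) :=
  let A : Polynomial (Polynomial ℝ) := P.map Polynomial.C
  let A' : Polynomial (Polynomial ℝ) := P.derivative.map Polynomial.C
  let A'' : Polynomial (Polynomial ℝ) := P.derivative.derivative.map Polynomial.C
  let B : Polynomial (Polynomial ℝ) := Polynomial.C Q
  let B' : Polynomial (Polynomial ℝ) := Polynomial.C Q.derivative
  let B'' : Polynomial (Polynomial ℝ) := Polynomial.C Q.derivative.derivative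
  (-2) * A ^ 2 * A' ^ 2 * B' - 2 * A' * B ^ 2 * B' ^ 2
    + 2 * A ^ 2 * A' * B' ^ 2 + 2 * A' ^ 2 * B ^ 2 * B'
    + 2 * A' * B' ^ 2 + 2 * A' ^ 2 * B'
    + A' * B * B'' + A * A'' * B'
    + A ^ 2 * A' * B * B'' + A * A'' * B ^ 2 * B'
    + A' * B ^ 3 * B'' + A ^ 3 * A'' * B'

open Polynomial in
/-- `numPoly` as a sum of products of a polynomial in `u` and a polynomial in `v`. -/
lemma numPoly_eq_sum (P Q : Polynomial ℝ) :
    numPoly P Q =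
      (P ^ 3 * derivative (derivative P) - 2 * (P ^ 2 * derivative P ^ 2)).map C * C (derivative Q)
      + (P ^ 2 * derivative P).map C * C (2 * derivative Q ^ 2 + Q * derivative (derivative Q))
      + (derivative P ^ 2).map C * C (2 * Q ^ 2 * derivative Q + 2 * derivative Q)
      + (P * derivative (derivative P)).map C * C (derivative Q + Q ^ 2 * derivative Q)
      + (derivative P).map C * C (-2 * Q ^ 2 * derivative Q ^ 2 + 2 * derivative Q ^ 2
          + Q * derivative (derivative Q) + Q ^ 3 * derivative (derivative Q)) := by
  simp only [numPoly, Polynomial.map_sub, Polynomial.map_mul,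
    Polynomial.map_pow, map_add, map_mul, map_pow, map_neg, Polynomial.map_ofNat, map_ofNat]
  ring

open Polynomial in
/-- Evaluating `numPoly` gives `num` of the associated polynomial functions. -/
lemma eval_eval_numPoly (P Q : Polynomial ℝ) (u v : ℝ) :
    ((numPoly P Q).eval (C u)).eval v = num (fun x => P.eval x) (fun x => Q.eval x) u v := by
  have hderiv (R : Polynomial ℝ) :
      deriv (fun x => R.eval x) = fun x => (derivative R).eval x := by
    ext x
    exact R.deriv
  have hmap (R : Polynomial ℝ) : (R.map C).eval (C u) = C (R.eval u) := by
    rw [eval_map, eval₂_at_apply]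
  simp [numPoly, num, hderiv, hmap]

open Polynomial in
/-- A bivariate polynomial over an infinite domain vanishing at every point is zero. -/
lemma eq_zero_of_eval_eval_eq_zero {R : Type*} [CommRing R] [IsDomain R] [Infinite R]
    {p : Polynomial (Polynomial R)} (h : ∀ u v : R, (p.eval (C u)).eval v = 0) : p = 0 := by
  ext1 k
  refine Polynomial.funext fun v => ?_
  have hmap : p.map (evalRingHom v) = 0 := by
    refine Polynomial.funext fun u => ?_
    have hv := (eval_map_apply (f := evalRingHom v) (p := p) (C u)).trans (h u v)
    simpa using hv
  simpa using congrArg (fun q => q.coeff k) hmap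

open Polynomial in
/-- The top coefficient in `u` of `numPoly P Q`. -/
lemma coeff_numPoly (P Q : Polynomial ℝ) (k : ℕ) (hP : P.natDegree = k + 2) (hk : 1 ≤ k) :
    (numPoly P Q).coeff (4 * k + 6) =
      C (-(((k : ℝ) + 2) * (k + 3)) * P.leadingCoeff ^ 4) * derivative Q := by
  have h0 : P.natDegree ≤ k + 2 := hP.le
  have h1 : (derivative P).natDegree ≤ k + 1 := (natDegree_derivative_le P).trans (by omega)
  have h2 : (derivative (derivative P)).natDegree ≤ k :=
    (natDegree_derivative_le _).trans (by omega)
  have c0 : P.coeff (k + 2) = P.leadingCoeff := by rw [← hP]; rfl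
  have c1 : (derivative P).coeff (k + 1) = P.leadingCoeff * (k + 2) := by
    rw [coeff_derivative, c0]; push_cast; ring
  have c2 : (derivative (derivative P)).coeff k = P.leadingCoeff * (k + 2) * (k + 1) := by
    rw [coeff_derivative, c1]
  have t1 : (P ^ 3 * derivative (derivative P)).coeff (4 * k + 6) =
      P.leadingCoeff ^ 3 * (P.leadingCoeff * (k + 2) * (k + 1)) := by
    rw [show 4 * k + 6 = 3 * (k + 2) + k by ring,
      coeff_mul_add_eq_of_natDegree_le (natDegree_pow_le_of_le 3 h0) h2,
      coeff_pow_of_natDegree_le h0, c0, c2]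
  have t2 : (P ^ 2 * derivative P ^ 2).coeff (4 * k + 6) =
      P.leadingCoeff ^ 2 * (P.leadingCoeff * (k + 2)) ^ 2 := by
    rw [show 4 * k + 6 = 2 * (k + 2) + 2 * (k + 1) by ring,
      coeff_mul_add_eq_of_natDegree_le (natDegree_pow_le_of_le 2 h0) (natDegree_pow_le_of_le 2 h1),
      coeff_pow_of_natDegree_le h0, coeff_pow_of_natDegree_le h1, c0, c1]
  have t3 : (P ^ 2 * derivative P).coeff (4 * k + 6) = 0 :=
    coeff_eq_zero_of_natDegree_lt <|
      (natDegree_mul_le_of_le (natDegree_pow_le_of_le 2 h0) h1).trans_lt (by omega)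
  have t4 : (derivative P ^ 2).coeff (4 * k + 6) = 0 :=
    coeff_eq_zero_of_natDegree_lt <| (natDegree_pow_le_of_le 2 h1).trans_lt (by omega)
  have t5 : (P * derivative (derivative P)).coeff (4 * k + 6) = 0 :=
    coeff_eq_zero_of_natDegree_lt <| (natDegree_mul_le_of_le h0 h2).trans_lt (by omega)
  have t6 : (derivative P).coeff (4 * k + 6) = 0 :=
    coeff_eq_zero_of_natDegree_lt <| h1.trans_lt (by omega)
  rw [numPoly_eq_sum]
  simp only [coeff_add, coeff_mul_C, coeff_map, coeff_sub, coeff_ofNat_mul, t1, t2, t3, t4, t5,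
    t6, map_zero, zero_mul, add_zero]
  congr 2
  ring

/-- If `α`, `β` are polynomials of degrees `m > n ≥ 2` with leading coefficients
`a_m`, `b_n`, then the coefficient of `u^(4m-2)·v^(n-1)` in `num` equals
`-m·n·(m+1)·a_m⁴·b_n ≠ 0`; in particular `num` is not identically zero, so no
such polynomial translation surface has vanishing second Gaussian curvature. -/
theorem stmt_15 (P Q : Polynomial ℝ) (m n : ℕ)
    (hm : P.natDegree = m) (hn : Q.natDegree = n) (hmn : m > n) (hn2 : 2 ≤ n) :
    ((numPoly P Q).coeff (4 * m - 2)).coeff (n - 1) =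
      -((m : ℝ) * n * (m + 1)) * P.leadingCoeff ^ 4 * Q.leadingCoeff ∧
    ((numPoly P Q).coeff (4 * m - 2)).coeff (n - 1) ≠ 0 ∧
    numPoly P Q ≠ 0 ∧
    ¬ ∀ u v : ℝ, num (fun x => P.eval x) (fun x => Q.eval x) u v = 0 := by
  have hcoeff : ((numPoly P Q).coeff (4 * m - 2)).coeff (n - 1) =
      -((m : ℝ) * n * (m + 1)) * P.leadingCoeff ^ 4 * Q.leadingCoeff := by
    obtain ⟨k, rfl⟩ : ∃ k, m = k + 2 := ⟨m - 2, by omega⟩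
    obtain ⟨l, rfl⟩ : ∃ l, n = l + 1 := ⟨n - 1, by omega⟩
    have hQ : Q.coeff (l + 1) = Q.leadingCoeff := by rw [← hn]; rfl
    rw [show 4 * (k + 2) - 2 = 4 * k + 6 by omega, coeff_numPoly P Q k hm (by omega),
      Nat.add_sub_cancel, Polynomial.coeff_C_mul, Polynomial.coeff_derivative, hQ]
    push_cast
    ring
  have hne : ((numPoly P Q).coeff (4 * m - 2)).coeff (n - 1) ≠ 0 := by
    have hP0 : P ≠ 0 := by rintro rfl; simp at hm; omega
    have hQ0 : Q ≠ 0 := by rintro rfl; simp at hn; omega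
    have hm0 : (m : ℝ) ≠ 0 := by norm_cast; omega
    have hn0 : (n : ℝ) ≠ 0 := by norm_cast; omega
    have hm1 : (m : ℝ) + 1 ≠ 0 := by positivity
    rw [hcoeff]
    simp [hP0, hQ0, hm0, hn0, hm1]
  have hpoly : numPoly P Q ≠ 0 := fun h => hne (by simp [h])
  exact ⟨hcoeff, hne, hpoly, fun h => hpoly <|
    eq_zero_of_eval_eval_eq_zero fun u v => (eval_eval_numPoly P Q u v).trans (h u v)⟩
end
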